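/- Let T be a C_{2,ϖ} orientation-preserving circle diffeomorphism with irrational rotation number. Fix a marked point ξ₀ with ξᵢ = Tⁱξ₀. Then there is a constant C > 0 such that for every n ∈ ℕ: (i) for all ξ, η ∈ Δ₀⁽ⁿ⁻¹⁾, |log Dist(ξ₀, ξ, ξ_{q_{n−1}}, η; T^{qₙ})| ≤ C ϖ(l_{n−1}); and (ii) for all ξ, η ∈ Δ₀⁽ⁿ⁻²⁾, |log Dist(ξ₀, ξ, ξ_{qₙ}, η; T^{q_{n−1}})| ≤ C ϖ(lₙ). Here the cross-ratio distortion is computed using lifts of the four points lying in a common interval of length less than 1 and the corresponding lift of the iterate of T, with the convention (f(x)−f(x))/(x−x) := f′(x) when two of the points coincide. -/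

import Mathlib

/-- A modulus of continuity. -/
structure IsModulus (w : ℝ → ℝ) : Prop where
  pos : ∀ x : ℝ, 0 < x → 0 < w x
  strictMono : StrictMonoOn w (Set.Ioi 0)
  continuous : ContinuousOn w (Set.Ioi 0)
  subadd : ∀ x y : ℝ, 0 < x → 0 < y → w (x + y) ≤ w x + w y
  tendsto : Filter.Tendsto w (nhdsWithin 0 (Set.Ioi 0)) (nhds 0)

/-- Divided difference with the convention `(f(x)−f(x))/(x−x) := f′(x)`. -/
noncomputable def dd (f : ℝ → ℝ) (a b : ℝ) : ℝ :=
  if a = b then deriv f a else (f a - f b) / (a - b)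

/-- Cross-ratio distortion `Dist(x₁,x₂,x₃,x₄;f)`, written via divided differences
(for pairwise distinct points this equals `Cr(f x₁,…)/Cr(x₁,…)`, and the divided
differences implement the convention when two points coincide). -/
noncomputable def distortion (f : ℝ → ℝ) (x₁ x₂ x₃ x₄ : ℝ) : ℝ :=
  dd f x₁ x₂ * dd f x₃ x₄ / (dd f x₂ x₃ * dd f x₄ x₁)

theorem dd_comm (f : ℝ → ℝ) (a b : ℝ) : dd f a b = dd f b a := by
  unfold dd
  by_cases h : a = b
  · simp [h]
  · rw [if_neg h, if_neg (Ne.symm h), ← neg_sub (f b), ← neg_sub b, neg_div_neg_eq]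

/-- A primitive of `t ↦ f' (y + t (a - y))` whose increment over `[0, 1]` is `dd f a y`. -/
theorem exists_hasDerivAt_dd {f f' : ℝ → ℝ} (hf : ∀ x, HasDerivAt f (f' x) x) (a y : ℝ) :
    ∃ ψ : ℝ → ℝ, (∀ t, HasDerivAt ψ (f' (y + t * (a - y))) t) ∧ ψ 1 - ψ 0 = dd f a y := by
  by_cases h : a = y
  · subst h
    refine ⟨fun t => t * f' a, fun t => ?_, ?_⟩
    · simpa using (hasDerivAt_id t).mul_const (f' a)
    · simp [dd, (hf a).deriv]
  · have h0 : a - y ≠ 0 := sub_ne_zero.mpr h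
    refine ⟨fun t => f (y + t * (a - y)) / (a - y), fun t => ?_, ?_⟩
    · have h1 : HasDerivAt (fun t : ℝ => y + t * (a - y)) (a - y) t := by
        simpa using ((hasDerivAt_id t).mul_const (a - y)).const_add y
      have h2 := ((hf (y + t * (a - y))).comp t h1).div_const (a - y)
      rwa [mul_div_assoc, div_self h0, mul_one] at h2
    · simp [dd, h, sub_div]

theorem abs_dd_sub_dd_sub_le {f f' : ℝ → ℝ} (hf : ∀ x, HasDerivAt f (f' x) x)
    {κ K α β : ℝ} (hK : ∀ u ∈ Set.Icc α β, ∀ v ∈ Set.Icc α β,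
      |f' u - f' v - κ * (u - v)| ≤ K * |u - v|)
    {a b y : ℝ} (ha : a ∈ Set.Icc α β) (hb : b ∈ Set.Icc α β) (hy : y ∈ Set.Icc α β) :
    |dd f a y - dd f b y - κ * (a - b) / 2| ≤ K * |a - b| := by
  obtain ⟨ψ, hψ, hψ1⟩ := exists_hasDerivAt_dd hf a y
  obtain ⟨χ, hχ, hχ1⟩ := exists_hasDerivAt_dd hf b y
  have hd : ∀ t, HasDerivAt (fun t => ψ t - χ t - κ * (a - b) * (t ^ 2 / 2))
      (f' (y + t * (a - y)) - f' (y + t * (b - y)) - κ * (a - b) * t) t := by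
    intro t
    have h1 : HasDerivAt (fun t : ℝ => t ^ 2 / 2) t t := by
      have := (hasDerivAt_pow 2 t).div_const 2
      simpa using this
    exact ((hψ t).sub (hχ t)).sub (h1.const_mul _)
  obtain ⟨t, ht, hmv⟩ := exists_hasDerivAt_eq_slope _ _ (zero_lt_one (α := ℝ))
    (fun x _ => (hd x).continuousAt.continuousWithinAt) (fun x _ => hd x)
  have hmem : ∀ x ∈ Set.Icc α β, y + t * (x - y) ∈ Set.Icc α β := by
    intro x hx
    have := (convex_Icc α β) hy hx (sub_nonneg.mpr ht.2.le) ht.1.le (by ring)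
    convert this using 1
    simp only [smul_eq_mul]
    ring
  have key := hK _ (hmem a ha) _ (hmem b hb)
  have huv : (y + t * (a - y)) - (y + t * (b - y)) = t * (a - b) := by ring
  have hK0 : 0 ≤ K * |a - b| := (abs_nonneg _).trans (hK a ha b hb)
  rw [huv, abs_mul, abs_of_pos ht.1] at key
  have e : dd f a y - dd f b y - κ * (a - b) / 2 =
      f' (y + t * (a - y)) - f' (y + t * (b - y)) - κ * (t * (a - b)) := by
    rw [← hψ1, ← hχ1]
    linear_combination -hmv
  rw [e]
  nlinarith [ht.2]

theorem exists_dd_eq {f f' : ℝ → ℝ} (hf : ∀ x, HasDerivAt f (f' x) x) (a b : ℝ) :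
    ∃ c, dd f a b = f' c := by
  obtain ⟨ψ, hψ, hψ1⟩ := exists_hasDerivAt_dd hf a b
  obtain ⟨t, -, hmv⟩ := exists_hasDerivAt_eq_slope _ _ (zero_lt_one (α := ℝ))
    (fun x _ => (hψ x).continuousAt.continuousWithinAt) (fun x _ => hψ x)
  exact ⟨_, by rw [← hψ1, hmv]; ring⟩

theorem abs_sub_sub_mul_le {f f' : ℝ → ℝ} (hf : ∀ x, HasDerivAt f (f' x) x)
    {κ K α β : ℝ} (hK : ∀ s ∈ Set.Icc α β, |f' s - κ| ≤ K) :
    ∀ u ∈ Set.Icc α β, ∀ v ∈ Set.Icc α β, |f u - f v - κ * (u - v)| ≤ K * |u - v| := by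
  intro u hu v hv
  have h := (convex_Icc α β).norm_image_sub_le_of_norm_hasDerivWithin_le
    (f := fun x => f x - κ * x) (f' := fun x => f' x - κ) (C := K)
    (fun x _ => by
      have h := (hf x).sub ((hasDerivAt_id x).const_mul κ)
      rw [mul_one] at h
      exact h.hasDerivWithinAt)
    hK hv hu
  simp only [Real.norm_eq_abs] at h
  convert h using 2
  ring

theorem abs_log_div_le {m A B : ℝ} (hm : 0 < m) (hA : m ≤ A) (hB : m ≤ B) :
    |Real.log (A / B)| ≤ |A - B| / m := by
  have aux : ∀ {A B : ℝ}, m ≤ A → m ≤ B → Real.log (A / B) ≤ |A - B| / m := by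
    intro A B hA hB
    have hB0 := hm.trans_le hB
    calc Real.log (A / B) ≤ A / B - 1 :=
          Real.log_le_sub_one_of_pos (div_pos (hm.trans_le hA) hB0)
      _ = (A - B) / B := by field_simp
      _ ≤ |A - B| / B := by gcongr; exact le_abs_self _
      _ ≤ |A - B| / m := by gcongr
  refine abs_le.mpr ⟨?_, aux hA hB⟩
  have := aux hB hA
  rw [abs_sub_comm, ← inv_div, Real.log_inv] at this
  linarith

theorem IsModulus.mono {w : ℝ → ℝ} (hw : IsModulus w) {x y : ℝ} (hx : 0 < x) (h : x ≤ y) :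
    w x ≤ w y :=
  hw.strictMono.monotoneOn hx (hx.trans_le h) h

theorem IsModulus.le_nsmul {w : ℝ → ℝ} (hw : IsModulus w) {x : ℝ} (hx : 0 < x) (n : ℕ) :
    w ((n + 1 : ℕ) * x) ≤ (n + 1 : ℕ) * w x := by
  induction n with
  | zero => simp
  | succ n ih =>
    have h := hw.subadd ((n + 1 : ℕ) * x) x (by positivity) hx
    push_cast at *
    rw [show ((n : ℝ) + 1 + 1) * x = (n + 1) * x + x by ring]
    linarith

/-- The quotient `w x / x` is decreasing up to a factor `2`. -/
theorem IsModulus.mul_le_two_mul {w : ℝ → ℝ} (hw : IsModulus w) {d L : ℝ}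
    (hd : 0 < d) (h : d ≤ L) : d * w L ≤ 2 * L * w d := by
  have hL : 0 < L := hd.trans_le h
  have h1 : L < (⌊L / d⌋₊ + 1 : ℕ) * d := by
    have := Nat.lt_floor_add_one (L / d)
    rw [div_lt_iff₀ hd] at this
    exact_mod_cast this
  have h2 : ((⌊L / d⌋₊ + 1 : ℕ) : ℝ) * d ≤ 2 * L := by
    have := Nat.floor_le (div_pos hL hd).le
    rw [le_div_iff₀ hd] at this
    push_cast
    linarith
  have h3 := (hw.mono hL h1.le).trans (hw.le_nsmul hd _)
  have h4 := hw.pos d hd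
  calc d * w L ≤ d * (((⌊L / d⌋₊ + 1 : ℕ) : ℝ) * w d) := by gcongr
    _ = ((⌊L / d⌋₊ + 1 : ℕ) : ℝ) * d * w d := by ring
    _ ≤ 2 * L * w d := by gcongr

theorem abs_log_distortion_le {w : ℝ → ℝ} (hw : IsModulus w) {F F' F'' : ℝ → ℝ}
    (hF' : ∀ x, HasDerivAt F (F' x) x) (hF'' : ∀ x, HasDerivAt F' (F'' x) x)
    (hmod : ∀ x y : ℝ, x ≠ y → |F'' x - F'' y| ≤ w |x - y|)
    {μ M B : ℝ} (hμ : 0 < μ) (hμF : ∀ x, μ ≤ F' x) (hMF : ∀ x, F' x ≤ M)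
    (hB : ∀ x, |F'' x| ≤ B)
    {α β x₁ x₂ x₃ x₄ : ℝ} (hαβ : α < β) (hβ : β - α ≤ 1)
    (h₁ : x₁ ∈ Set.Icc α β) (h₂ : x₂ ∈ Set.Icc α β) (h₃ : x₃ ∈ Set.Icc α β)
    (h₄ : x₄ ∈ Set.Icc α β) (h₁₃ : x₁ ≠ x₃) :
    |Real.log (distortion F x₁ x₂ x₃ x₄)| ≤
      2 * ((B ^ 2 / w 1 + 2 * M) / μ ^ 2) * (β - α) * w |x₁ - x₃| := by
  have hL : 0 < β - α := sub_pos.mpr hαβ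
  set L := β - α with hLdef
  have hdL : ∀ {x y : ℝ}, x ∈ Set.Icc α β → y ∈ Set.Icc α β → |x - y| ≤ L := by
    intro x y hx hy
    rw [hLdef, abs_le]
    constructor <;> linarith [hx.1, hx.2, hy.1, hy.2]
  have hB0 : 0 ≤ B := (abs_nonneg _).trans (hB 0)
  have hw1 := hw.pos 1 one_pos
  have hwL := hw.pos L hL
  have ddμ : ∀ a b, μ ≤ dd F a b := fun a b => by
    obtain ⟨c, hc⟩ := exists_dd_eq hF' a b
    exact hc ▸ hμF c
  have ddM : ∀ a b, dd F a b ≤ M := fun a b => by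
    obtain ⟨c, hc⟩ := exists_dd_eq hF' a b
    exact hc ▸ hMF c
  have habs : ∀ a b, |dd F a b| ≤ M := fun a b => by
    rw [abs_of_pos (hμ.trans_le (ddμ a b))]
    exact ddM a b
  have hM0 : 0 ≤ M := hμ.le.trans ((hμF 0).trans (hMF 0))
  have hlip := abs_sub_sub_mul_le hF'' (α := α) (β := β) (κ := 0) (K := B)
    (fun s _ => by simpa using hB s)
  have hlin := abs_sub_sub_mul_le hF'' (α := α) (β := β) (κ := F'' x₁) (K := w L)
    (fun s hs => by
      rcases eq_or_ne s x₁ with rfl | hne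
      · simpa using hwL.le
      · exact (hmod s x₁ hne).trans (hw.mono (abs_pos.mpr (sub_ne_zero.mpr hne)) (hdL hs h₁)))
  have e2 := abs_dd_sub_dd_sub_le hF' hlin h₁ h₃ h₂
  have e4 := abs_dd_sub_dd_sub_le hF' hlin h₁ h₃ h₄
  have e24 : |dd F x₄ x₃ - dd F x₂ x₃| ≤ B * L := by
    have := abs_dd_sub_dd_sub_le hF' hlip h₄ h₂ h₃
    simp only [zero_mul, zero_div, sub_zero] at this
    exact this.trans (by gcongr; exact hdL h₄ h₂)
  have hBL : B * (B * L) ≤ 2 * (B ^ 2 / w 1 * w L) := by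
    have := hw.mul_le_two_mul hL hβ
    rw [show B * (B * L) = B ^ 2 / w 1 * (L * w 1) by field_simp,
      show 2 * (B ^ 2 / w 1 * w L) = B ^ 2 / w 1 * (2 * 1 * w L) by ring]
    gcongr
  have hdiff : |dd F x₁ x₂ * dd F x₃ x₄ - dd F x₂ x₃ * dd F x₄ x₁| ≤
      (B ^ 2 / w 1 + 2 * M) * (|x₁ - x₃| * w L) := by
    rw [dd_comm F x₃ x₄, dd_comm F x₄ x₁]
    have hE : dd F x₁ x₂ * dd F x₄ x₃ - dd F x₂ x₃ * dd F x₁ x₄ =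
        (dd F x₁ x₂ - dd F x₃ x₂ - F'' x₁ * (x₁ - x₃) / 2) * dd F x₄ x₃
        - dd F x₂ x₃ * (dd F x₁ x₄ - dd F x₃ x₄ - F'' x₁ * (x₁ - x₃) / 2)
        + F'' x₁ * (x₁ - x₃) / 2 * (dd F x₄ x₃ - dd F x₂ x₃) := by
      rw [dd_comm F x₃ x₂, dd_comm F x₃ x₄]
      ring
    rw [hE]
    refine (abs_add_le _ _).trans ((add_le_add_left (abs_sub _ _) _).trans ?_)
    rw [abs_mul, abs_mul, abs_mul, abs_div, abs_mul, abs_two]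
    have t1 : |dd F x₁ x₂ - dd F x₃ x₂ - F'' x₁ * (x₁ - x₃) / 2| * |dd F x₄ x₃| ≤
        w L * |x₁ - x₃| * M := by gcongr; exact habs _ _
    have t2 : |dd F x₂ x₃| * |dd F x₁ x₄ - dd F x₃ x₄ - F'' x₁ * (x₁ - x₃) / 2| ≤
        M * (w L * |x₁ - x₃|) := by gcongr; exact habs _ _
    have t3 : |F'' x₁| * |x₁ - x₃| / 2 * |dd F x₄ x₃ - dd F x₂ x₃| ≤
        B * |x₁ - x₃| / 2 * (B * L) := by gcongr; exact hB _
    have t4 := mul_le_mul_of_nonneg_left hBL (abs_nonneg (x₁ - x₃))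
    linarith
  have hlow : ∀ a b c d, μ ^ 2 ≤ dd F a b * dd F c d := fun a b c d => by
    rw [sq]
    exact mul_le_mul (ddμ _ _) (ddμ _ _) hμ.le (hμ.le.trans (ddμ _ _))
  calc |Real.log (distortion F x₁ x₂ x₃ x₄)|
      ≤ |dd F x₁ x₂ * dd F x₃ x₄ - dd F x₂ x₃ * dd F x₄ x₁| / μ ^ 2 :=
        abs_log_div_le (by positivity) (hlow _ _ _ _) (hlow _ _ _ _)
    _ ≤ (B ^ 2 / w 1 + 2 * M) * (2 * L * w |x₁ - x₃|) / μ ^ 2 := by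
        have := hw.mul_le_two_mul (abs_pos.mpr (sub_ne_zero.mpr h₁₃)) (hdL h₁ h₃)
        gcongr
        exact hdiff.trans (mul_le_mul_of_nonneg_left this (by positivity))
    _ = _ := by ring

theorem dd_iterate_succ {F F' : ℝ → ℝ} (hF' : ∀ x, HasDerivAt F (F' x) x) (hF : StrictMono F)
    (n : ℕ) (a b : ℝ) :
    dd F^[n + 1] a b = dd F (F^[n] a) (F^[n] b) * dd F^[n] a b := by
  by_cases h : a = b
  · subst h
    have hd : Differentiable ℝ F := fun x => (hF' x).differentiableAt
    simp only [dd, if_true, Function.iterate_succ']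
    exact deriv_comp a (hd _) (hd.iterate n a)
  · have h1 : F^[n] a ≠ F^[n] b := (hF.injective.iterate n).ne h
    have h2 := sub_ne_zero.mpr h1
    simp only [dd, if_neg h, if_neg h1, Function.iterate_succ_apply']
    field_simp

theorem dd_iterate_pos {F F' : ℝ → ℝ} (hF' : ∀ x, HasDerivAt F (F' x) x) (hF : StrictMono F)
    (hpos : ∀ x, 0 < F' x) (n : ℕ) (a b : ℝ) : 0 < dd F^[n] a b := by
  induction n with
  | zero =>
    obtain ⟨c, hc⟩ := exists_dd_eq (f := F^[0]) (f' := fun _ => 1) (fun x => hasDerivAt_id x) a b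
    rw [hc]
    exact one_pos
  | succ n ih =>
    rw [dd_iterate_succ hF' hF]
    obtain ⟨c, hc⟩ := exists_dd_eq hF' (F^[n] a) (F^[n] b)
    exact mul_pos (hc ▸ hpos c) ih

theorem log_distortion_iterate {F F' : ℝ → ℝ} (hF' : ∀ x, HasDerivAt F (F' x) x)
    (hF : StrictMono F) (hpos : ∀ x, 0 < F' x) (n : ℕ) (x₁ x₂ x₃ x₄ : ℝ) :
    Real.log (distortion F^[n] x₁ x₂ x₃ x₄) = ∑ i ∈ Finset.range n,
      Real.log (distortion F (F^[i] x₁) (F^[i] x₂) (F^[i] x₃) (F^[i] x₄)) := by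
  have hp := dd_iterate_pos hF' hF hpos
  have hp1 : ∀ a b, 0 < dd F a b := hp 1
  have hD : ∀ {f : ℝ → ℝ} (_ : ∀ a b, 0 < dd f a b) (a b c d : ℝ), 0 < distortion f a b c d :=
    fun h a b c d => div_pos (mul_pos (h _ _) (h _ _)) (mul_pos (h _ _) (h _ _))
  induction n with
  | zero =>
    have : ∀ a b, dd id a b = 1 := fun a b => by
      obtain ⟨c, hc⟩ := exists_dd_eq (f' := fun _ => 1) (fun x => hasDerivAt_id x) a b
      exact hc
    simp [distortion, this]
  | succ n ih =>
    rw [Finset.sum_range_succ, ← ih,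
      ← Real.log_mul (hD (hp n) _ _ _ _).ne' (hD hp1 _ _ _ _).ne']
    congr 1
    simp only [distortion, dd_iterate_succ hF' hF]
    rw [div_mul_div_comm]
    congr 1 <;> ring

theorem abs_log_distortion_iterate_le {w : ℝ → ℝ} (hw : IsModulus w) {F F' F'' : ℝ → ℝ}
    (hF : StrictMono F)
    (hF' : ∀ x, HasDerivAt F (F' x) x) (hF'' : ∀ x, HasDerivAt F' (F'' x) x)
    (hmod : ∀ x y : ℝ, x ≠ y → |F'' x - F'' y| ≤ w |x - y|)
    {μ M B : ℝ} (hμ : 0 < μ) (hμF : ∀ x, μ ≤ F' x) (hMF : ∀ x, F' x ≤ M)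
    (hB : ∀ x, |F'' x| ≤ B) {N : ℕ}
    {α β x₁ x₂ x₃ x₄ Λ : ℝ} (hαβ : α < β)
    (hsum : ∑ i ∈ Finset.range N, (F^[i] β - F^[i] α) ≤ 1)
    (h₁ : x₁ ∈ Set.Icc α β) (h₂ : x₂ ∈ Set.Icc α β) (h₃ : x₃ ∈ Set.Icc α β)
    (h₄ : x₄ ∈ Set.Icc α β) (h₁₃ : x₁ ≠ x₃)
    (hΛ : ∀ i, |F^[i] x₁ - F^[i] x₃| ≤ Λ) :
    |Real.log (distortion F^[N] x₁ x₂ x₃ x₄)| ≤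
      2 * ((B ^ 2 / w 1 + 2 * M) / μ ^ 2) * w Λ := by
  have hmono : ∀ i, StrictMono F^[i] := fun i => hF.iterate i
  have hpos : ∀ i ∈ Finset.range N, 0 ≤ F^[i] β - F^[i] α :=
    fun i _ => sub_nonneg.mpr (hmono i hαβ).le
  have hmem : ∀ i, ∀ x ∈ Set.Icc α β, F^[i] x ∈ Set.Icc (F^[i] α) (F^[i] β) :=
    fun i x hx => ⟨(hmono i).monotone hx.1, (hmono i).monotone hx.2⟩
  have hK : 0 ≤ 2 * ((B ^ 2 / w 1 + 2 * M) / μ ^ 2) := by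
    have := hw.pos 1 one_pos
    have := hμ.le.trans ((hμF 0).trans (hMF 0))
    positivity
  have hwΛ : 0 ≤ w Λ :=
    (hw.pos _ ((abs_pos.mpr (sub_ne_zero.mpr h₁₃)).trans_le (hΛ 0))).le
  rw [log_distortion_iterate hF' hF (fun x => hμ.trans_le (hμF x))]
  calc _ ≤ ∑ i ∈ Finset.range N,
        |Real.log (distortion F (F^[i] x₁) (F^[i] x₂) (F^[i] x₃) (F^[i] x₄))| :=
        Finset.abs_sum_le_sum_abs _ _
    _ ≤ ∑ i ∈ Finset.range N,
        2 * ((B ^ 2 / w 1 + 2 * M) / μ ^ 2) * (F^[i] β - F^[i] α) * w Λ := by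
        refine Finset.sum_le_sum fun i hi => ?_
        have hne := (hmono i).injective.ne h₁₃
        refine (abs_log_distortion_le hw hF' hF'' hmod hμ hμF hMF hB (hmono i hαβ)
          ((Finset.single_le_sum hpos hi).trans hsum) (hmem i _ h₁) (hmem i _ h₂)
          (hmem i _ h₃) (hmem i _ h₄) hne).trans ?_
        have := hpos i hi
        have := hw.mono (abs_pos.mpr (sub_ne_zero.mpr hne)) (hΛ i)
        gcongr
    _ = 2 * ((B ^ 2 / w 1 + 2 * M) / μ ^ 2) * w Λ *
        ∑ i ∈ Finset.range N, (F^[i] β - F^[i] α) := by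
        rw [Finset.mul_sum]
        exact Finset.sum_congr rfl fun i _ => by ring
    _ ≤ 2 * ((B ^ 2 / w 1 + 2 * M) / μ ^ 2) * w Λ * 1 := by gcongr
    _ = _ := mul_one _

/-- Finitely many intervals with pairwise disjoint integer translates have total length at most
`1`. -/
theorem sum_sub_le_one {N : ℕ} {A B : ℕ → ℝ} (hAB : ∀ i < N, A i < B i)
    (hinj : ∀ i < N, ∀ j < N, ∀ n : ℤ, A i = A j + n → i = j ∧ n = 0)
    (hsep : ∀ i < N, ∀ j < N, ∀ n : ℤ, A i < A j + n → B i ≤ A j + n) :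
    ∑ i ∈ Finset.range N, (B i - A i) ≤ 1 := by
  have hkey : ∀ i < N, ∀ j < N, ∀ n : ℤ, ∀ x y : ℝ, x ∈ Set.Ioo (A i) (B i) →
      y ∈ Set.Ioo (A j) (B j) → x = y + n → i = j ∧ n = 0 := by
    intro i hi j hj n x y hx hy hxy
    rcases lt_trichotomy (A i) (A j + n) with h | h | h
    · have := hsep i hi j hj n h
      linarith [hx.2, hy.1]
    · exact hinj i hi j hj n h
    · have := hsep j hj i hi (-n) (by push_cast; linarith)
      push_cast at this
      linarith [hx.1, hy.2]
  have hvol := (isAddFundamentalDomain_Ioc (zero_lt_one (α := ℝ)) 0).measure_le_of_pairwise_disjoint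
    (t := ⋃ i ∈ Finset.range N, Set.Ioo (A i) (B i))
    (Finset.measurableSet_biUnion _ fun i _ => measurableSet_Ioo).nullMeasurableSet (by
      intro g₁ g₂ hne
      refine Disjoint.aedisjoint ((Disjoint.inf_left _ ?_).inf_right _)
      rw [Set.disjoint_left]
      rintro _ ⟨x, hx, rfl⟩ ⟨y, hy, hxy⟩
      simp only [Set.mem_iUnion, Finset.mem_range, exists_prop] at hx hy
      obtain ⟨i, hi, hx⟩ := hx
      obtain ⟨j, hj, hy⟩ := hy
      obtain ⟨a, ha⟩ := AddSubgroup.mem_zmultiples_iff.mp g₁.2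
      obtain ⟨b, hb⟩ := AddSubgroup.mem_zmultiples_iff.mp g₂.2
      simp only [zsmul_eq_mul, mul_one] at ha hb
      have hxy' : (b : ℝ) + y = a + x := by
        rw [ha, hb]
        exact hxy
      have h := (hkey i hi j hj (b - a) x y hx hy (by push_cast; linarith)).2
      refine hne (Subtype.ext ?_)
      rw [← ha, ← hb, sub_eq_zero.mp h])
  rw [MeasureTheory.measure_biUnion_finset (by
      intro i hi j hj hij
      refine Set.disjoint_left.mpr fun x hx hy => hij ?_
      exact (hkey i (by simpa using hi) j (by simpa using hj) 0 x x hx hy (by simp)).1)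
    fun i _ => measurableSet_Ioo] at hvol
  simp only [Real.volume_Ioo, Real.volume_Ioc] at hvol
  rw [← ENNReal.ofReal_sum_of_nonneg fun i hi =>
    (sub_pos.mpr (hAB i (Finset.mem_range.mp hi))).le] at hvol
  simpa using (ENNReal.ofReal_le_ofReal_iff (by norm_num)).mp hvol

theorem eq_zero_of_irrational_mul_eq {ρ : ℝ} (hρ : Irrational ρ) {a n : ℤ} (h : a * ρ = n) :
    a = 0 ∧ n = 0 := by
  by_cases ha : a = 0
  · subst ha
    simp only [Int.cast_zero, zero_mul] at h
    exact ⟨rfl, by exact_mod_cast h.symm⟩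
  · exact absurd h ((hρ.intCast_mul ha).ne_int n)

namespace CircleDeg1Lift

theorem iterate_lt_of_mul_translationNumber_lt (f : CircleDeg1Lift) {i j : ℕ} {n : ℤ}
    (h : i * translationNumber f < j * translationNumber f + n) (x : ℝ) :
    f^[i] x < f^[j] x + n := by
  rcases le_total i j with hij | hij
  · obtain ⟨d, rfl⟩ := Nat.exists_eq_add_of_le hij
    have := lt_map_of_int_lt_translationNumber (f ^ d) (n := -n) (by
      rw [translationNumber_pow]
      push_cast at *
      linarith) (f^[i] x)
    rw [coe_pow, ← Function.iterate_add_apply, add_comm d i] at this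
    push_cast at this
    linarith
  · obtain ⟨d, rfl⟩ := Nat.exists_eq_add_of_le hij
    have := map_lt_of_translationNumber_lt_int (f ^ d) (n := n) (by
      rw [translationNumber_pow]
      push_cast at *
      linarith) (f^[j] x)
    rwa [coe_pow, ← Function.iterate_add_apply, add_comm d j] at this

theorem iterate_eq_iff (f : CircleDeg1Lift) (hf : Irrational (translationNumber f)) {i j : ℕ}
    {n : ℤ} (x : ℝ) : f^[i] x = f^[j] x + n ↔ i = j ∧ n = 0 := by
  refine ⟨fun h => ?_, by rintro ⟨rfl, rfl⟩; simp⟩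
  rcases lt_trichotomy (i * translationNumber f) (j * translationNumber f + n) with h' | h' | h'
  · exact absurd h (f.iterate_lt_of_mul_translationNumber_lt h' x).ne
  · have := eq_zero_of_irrational_mul_eq hf (a := i - j) (n := n) (by push_cast; linarith)
    omega
  · have := f.iterate_lt_of_mul_translationNumber_lt (i := j) (j := i) (n := -n)
      (by push_cast; linarith) x
    push_cast at this
    linarith

theorem iterate_lt_iff (f : CircleDeg1Lift) (hf : Irrational (translationNumber f)) {i j : ℕ}
    {n : ℤ} (x : ℝ) : f^[i] x < f^[j] x + n ↔
      i * translationNumber f < j * translationNumber f + n := by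
  refine ⟨fun h => ?_, fun h => f.iterate_lt_of_mul_translationNumber_lt h x⟩
  by_contra! h'
  rcases h'.lt_or_eq with h' | h'
  · have := f.iterate_lt_of_mul_translationNumber_lt (i := j) (j := i) (n := -n)
      (by push_cast; linarith) x
    push_cast at this
    linarith
  · have := eq_zero_of_irrational_mul_eq hf (a := i - j) (n := n) (by push_cast; linarith)
    obtain ⟨rfl, rfl⟩ : i = j ∧ n = 0 := by omega
    simp at h

theorem iterate_add_int (f : CircleDeg1Lift) (i : ℕ) (x : ℝ) (n : ℤ) :
    f^[i] (x + n) = f^[i] x + n := by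
  rw [← coe_pow]
  exact map_add_int _ _ _

end CircleDeg1Lift

section Convergents

variable {k p q : ℕ → ℕ}

theorem convergent_det (hp0 : p 0 = 0) (hp1 : p 1 = 1) (hq0 : q 0 = 1)
    (hprec : ∀ n, p (n + 2) = k (n + 2) * p (n + 1) + p n)
    (hqrec : ∀ n, q (n + 2) = k (n + 2) * q (n + 1) + q n) (n : ℕ) :
    (p (n + 1) * q n - p n * q (n + 1) : ℤ) = (-1) ^ n := by
  induction n with
  | zero => simp [hp0, hp1, hq0]
  | succ n ih =>
    rw [hprec, hqrec, pow_succ, ← ih]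
    push_cast
    ring

theorem convergent_denom_pos (hk : ∀ n, 1 ≤ k (n + 1)) (hq0 : q 0 = 1) (hq1 : q 1 = k 1)
    (hqrec : ∀ n, q (n + 2) = k (n + 2) * q (n + 1) + q n) (n : ℕ) : 0 < q n := by
  induction n using Nat.twoStepInduction with
  | zero => omega
  | one => rw [hq1]; exact hk 0
  | more n ih _ => rw [hqrec]; omega

theorem convergent_error_sign {ρ : ℝ} (hk : ∀ n, 1 ≤ k (n + 1))
    (hp0 : p 0 = 0) (hp1 : p 1 = 1) (hq0 : q 0 = 1) (hq1 : q 1 = k 1)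
    (hprec : ∀ n, p (n + 2) = k (n + 2) * p (n + 1) + p n)
    (hqrec : ∀ n, q (n + 2) = k (n + 2) * q (n + 1) + q n)
    (hconv : Filter.Tendsto (fun n => (p n : ℝ) / (q n : ℝ)) Filter.atTop (nhds ρ)) (n : ℕ) :
    0 < (-1 : ℝ) ^ n * (q n * ρ - p n) := by
  have hq : ∀ n, (0 : ℝ) < q n := fun n =>
    Nat.cast_pos.mpr (convergent_denom_pos hk hq0 hq1 hqrec n)
  have hstep : ∀ n, (-1 : ℝ) ^ n * (p n / q n) < (-1) ^ n * (p (n + 2) / q (n + 2)) := by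
    intro n
    have hD : (p (n + 1) * q n - p n * q (n + 1) : ℝ) = (-1) ^ n := by
      exact_mod_cast convergent_det hp0 hp1 hq0 hprec hqrec n
    have hkn : (0 : ℝ) < k (n + 2) := Nat.cast_pos.mpr (hk (n + 1))
    have hsq : ((-1 : ℝ) ^ n) * (-1) ^ n = 1 := by rw [← mul_pow]; simp
    have : (-1 : ℝ) ^ n * (p (n + 2) / q (n + 2)) - (-1) ^ n * (p n / q n) =
        k (n + 2) / (q (n + 2) * q n) := by
      have h1 := (hq n).ne'
      have h2 := (hq (n + 2)).ne'
      field_simp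
      have hp2 : (p (n + 2) : ℝ) = k (n + 2) * p (n + 1) + p n := by exact_mod_cast hprec n
      have hq2 : (q (n + 2) : ℝ) = k (n + 2) * q (n + 1) + q n := by exact_mod_cast hqrec n
      rw [hp2, hq2]
      linear_combination (k (n + 2) : ℝ) * (-1) ^ n * hD + (k (n + 2) : ℝ) * hsq
    have h3 : (0 : ℝ) < k (n + 2) / (q (n + 2) * q n) := div_pos hkn (mul_pos (hq _) (hq _))
    linarith
  have hpow : ∀ j, (-1 : ℝ) ^ (n + 2 * j) = (-1) ^ n := fun j => by
    rw [pow_add, pow_mul]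
    simp
  have hmono : Monotone fun j => (-1 : ℝ) ^ n * (p (n + 2 * j) / q (n + 2 * j)) :=
    monotone_nat_of_le_succ fun j => by
      have := (hstep (n + 2 * j)).le
      rwa [hpow] at this
  have hlim : Filter.Tendsto (fun j => (-1 : ℝ) ^ n * (p (n + 2 * j) / q (n + 2 * j)))
      Filter.atTop (nhds ((-1) ^ n * ρ)) :=
    (hconv.comp (Filter.tendsto_atTop_mono (fun j => show j ≤ n + 2 * j by omega)
      Filter.tendsto_id)).const_mul _
  have hlt := (hstep n).trans_le (hmono.ge_of_tendsto hlim 1)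
  have := mul_lt_mul_of_pos_right hlt (hq n)
  rw [mul_assoc, div_mul_cancel₀ _ (hq n).ne'] at this
  linarith

/-- The best approximation property of convergents. -/
theorem eq_zero_of_abs_lt_convergent_error {ρ : ℝ}
    (hdet : ∀ n, (p (n + 1) * q n - p n * q (n + 1) : ℤ) = (-1) ^ n)
    (hsign : ∀ n, 0 < (-1 : ℝ) ^ n * (q n * ρ - p n)) {m : ℕ} {a n : ℤ}
    (ha : |a| < q (m + 1)) (hlt : |a * ρ + n| < (-1) ^ m * (q m * ρ - p m)) :
    a = 0 ∧ n = 0 := by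
  have hD := hdet m
  obtain ⟨e, he⟩ : ∃ e : ℤ, e = (-1) ^ m := ⟨_, rfl⟩
  have heR : (e : ℝ) = (-1) ^ m := by rw [he]; push_cast; rfl
  have he2 : e * e = 1 := by rw [he, ← mul_pow]; simp
  have hx := hsign m
  have hy := hsign (m + 1)
  rw [pow_succ, ← heR] at hy
  rw [← heR] at hx hlt
  rw [← he] at hD
  obtain ⟨u, hu⟩ : ∃ u : ℤ, u = e * (a * p (m + 1) + n * q (m + 1)) := ⟨_, rfl⟩
  obtain ⟨v, hv⟩ : ∃ v : ℤ, v = e * (-n * q m - a * p m) := ⟨_, rfl⟩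
  have ha' : a = u * q m + v * q (m + 1) := by
    rw [hu, hv]
    linear_combination (-a * e) * hD - a * he2
  have hn' : n = -(u * p m + v * p (m + 1)) := by
    rw [hu, hv]
    linear_combination (-n * e) * hD - n * he2
  have hE : |(a : ℝ) * ρ + n| = |u * (e * (q m * ρ - p m)) -
      v * (e * -1 * (q (m + 1) * ρ - p (m + 1)))| := by
    have h1 : |(e : ℝ)| = 1 := by rw [heR]; simp
    have h2 : |(a : ℝ) * ρ + n| = |e * (a * ρ + n)| := by rw [abs_mul, h1, one_mul]
    rw [h2]
    congr 1
    rw [ha', hn']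
    push_cast
    ring
  rw [hE] at hlt
  set x : ℝ := e * (q m * ρ - p m)
  set y : ℝ := e * -1 * (q (m + 1) * ρ - p (m + 1))
  rw [abs_lt] at hlt ha
  have hqm : (0 : ℤ) ≤ q m := Int.natCast_nonneg _
  have hqm' : (0 : ℤ) ≤ q (m + 1) := Int.natCast_nonneg _
  rcases lt_trichotomy v 0 with hv0 | hv0 | hv0
  · rcases le_or_gt u 0 with hu0 | hu0
    · nlinarith
    · have h1 : (1 : ℝ) ≤ u := by exact_mod_cast hu0
      have h2 : (v : ℝ) ≤ 0 := by exact_mod_cast hv0.le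
      nlinarith
  · have hu0 : u = 0 := by
      rw [hv0] at hlt
      have h1 : (u : ℝ) < 1 := by
        by_contra! h
        push_cast at hlt
        nlinarith
      have h2 : (-1 : ℝ) < u := by
        by_contra! h
        push_cast at hlt
        nlinarith
      have h3 : u < 1 := by exact_mod_cast h1
      have h4 : -1 < u := by exact_mod_cast h2
      omega
    rw [ha', hn', hu0, hv0]
    simp
  · rcases le_or_gt 0 u with hu0 | hu0
    · nlinarith
    · have h1 : (u : ℝ) ≤ -1 := by exact_mod_cast Int.le_sub_one_of_lt hu0
      have h2 : (0 : ℝ) ≤ v := by exact_mod_cast hv0.le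
      nlinarith

end Convergents

theorem CircleDeg1Lift.abs_iterate_sub_sub_le (f : CircleDeg1Lift) (n : ℕ) (x : ℝ) :
    |f^[n] x - x - n * translationNumber f| ≤ 1 := by
  have h1 := map_lt_add_translationNumber_add_one (f ^ n) x
  have h2 := translationNumber_le_ceil_sub (f ^ n) x
  have h3 := Int.ceil_lt_add_one ((f ^ n) x - x)
  rw [translationNumber_pow, coe_pow] at h1 h2
  rw [coe_pow] at h3
  rw [abs_le]
  constructor <;> linarith

theorem periodic_of_hasDerivAt {f f' : ℝ → ℝ} {c : ℝ} (hf : ∀ x, HasDerivAt f (f' x) x)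
    (h : ∀ x, f (x + 1) = f x + c) : Function.Periodic f' 1 := fun x => by
  have h1 : HasDerivAt (fun y => f (y + 1)) (f' (x + 1)) x := (hf (x + 1)).comp_add_const x 1
  simp only [h] at h1
  exact h1.unique ((hf x).add_const c)

theorem exists_bounds_deriv {F F' F'' : ℝ → ℝ} (hFp : ∀ x, F (x + 1) = F x + 1)
    (hF' : ∀ x, HasDerivAt F (F' x) x) (hF'' : ∀ x, HasDerivAt F' (F'' x) x)
    (hpos : ∀ x, 0 < F' x) : (∃ μ, 0 < μ ∧ ∀ x, μ ≤ F' x) ∧ ∃ M, ∀ x, F' x ≤ M := by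
  have hc := (periodic_of_hasDerivAt hF' hFp).compact_of_continuous one_ne_zero
    (continuous_iff_continuousAt.mpr fun x => (hF'' x).continuousAt)
  have hne := Set.range_nonempty F'
  obtain ⟨a, ha⟩ := hc.sInf_mem hne
  exact ⟨⟨_, ha ▸ hpos a, fun x => csInf_le hc.bddBelow ⟨x, rfl⟩⟩,
    ⟨_, fun x => le_csSup hc.bddAbove ⟨x, rfl⟩⟩⟩

theorem exists_bound_second_deriv {w : ℝ → ℝ} (hw : IsModulus w) {F F' F'' : ℝ → ℝ}
    (hFp : ∀ x, F (x + 1) = F x + 1)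
    (hF' : ∀ x, HasDerivAt F (F' x) x) (hF'' : ∀ x, HasDerivAt F' (F'' x) x)
    (hmod : ∀ x y : ℝ, x ≠ y → |F'' x - F'' y| ≤ w |x - y|) : ∃ B, ∀ x, |F'' x| ≤ B := by
  have hper : Function.Periodic F'' 1 := periodic_of_hasDerivAt (c := 0) hF'' fun x => by
    rw [add_zero]
    exact periodic_of_hasDerivAt hF' hFp x
  refine ⟨w 1 + |F'' 0|, fun x => ?_⟩
  obtain ⟨y, hy, hxy⟩ := hper.exists_mem_Ioc one_pos x 0
  rw [zero_add] at hy
  have h := hmod y 0 hy.1.ne'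
  rw [sub_zero, abs_of_pos hy.1] at h
  rw [hxy]
  have := abs_sub_abs_le_abs_sub (F'' y) (F'' 0)
  linarith [hw.mono hy.1 hy.2]

/-- Lemma (log-distortion estimates): for a `C_{2,ϖ}` circle diffeomorphism,
`|log Dist(ξ₀, ξ, ξ_{q_{n−1}}, η; T^{qₙ})| ≤ C ϖ(l_{n−1})` for `ξ,η ∈ Δ₀⁽ⁿ⁻¹⁾`, and
`|log Dist(ξ₀, ξ, ξ_{qₙ}, η; T^{q_{n−1}})| ≤ C ϖ(lₙ)` for `ξ,η ∈ Δ₀⁽ⁿ⁻²⁾`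
(stated here with `n−1 = m` resp. `n−2 = m`, in lift coordinates). -/
theorem log_distortion_estimates
    (w : ℝ → ℝ) (hw : IsModulus w)
    (F F' F'' : ℝ → ℝ) (hF : StrictMono F) (hFp : ∀ x, F (x + 1) = F x + 1)
    (hF' : ∀ x, HasDerivAt F (F' x) x) (hF'' : ∀ x, HasDerivAt F' (F'' x) x)
    (hF'pos : ∀ x, 0 < F' x)
    (hmod : ∀ x y : ℝ, x ≠ y → |F'' x - F'' y| ≤ w |x - y|)
    (ρ : ℝ) (hρ : ρ ∈ Set.Ioo (0:ℝ) 1) (hirr : Irrational ρ)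
    (hrot : ∀ x : ℝ,
      Filter.Tendsto (fun n : ℕ => (F^[n] x - x) / (n : ℝ)) Filter.atTop (nhds ρ))
    (k p q : ℕ → ℕ) (hk : ∀ n, 1 ≤ k (n + 1))
    (hp0 : p 0 = 0) (hp1 : p 1 = 1) (hq0 : q 0 = 1) (hq1 : q 1 = k 1)
    (hprec : ∀ n, p (n + 2) = k (n + 2) * p (n + 1) + p n)
    (hqrec : ∀ n, q (n + 2) = k (n + 2) * q (n + 1) + q n)
    (hconv : Filter.Tendsto (fun n => (p n : ℝ) / (q n : ℝ)) Filter.atTop (nhds ρ))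
    (l : ℕ → ℝ) (hl : ∀ n, l n = ⨆ x : ℝ, |F^[q n] x - x - (p n : ℝ)|)
    -- `segC m x` is the m-th (closed) fundamental segment in lift coordinates
    (segC : ℕ → ℝ → Set ℝ)
    (hsegC : ∀ m x, segC m x =
      if Even m then Set.Icc x (F^[q m] x - (p m : ℝ))
      else Set.Icc (F^[q m] x - (p m : ℝ)) x) :
    ∀ ξ₀ : ℝ, ∃ C > 0, ∀ m : ℕ,
      (∀ ξ ∈ segC m ξ₀, ∀ η ∈ segC m ξ₀,
        |Real.log (distortion (F^[q (m + 1)]) ξ₀ ξ (F^[q m] ξ₀ - (p m : ℝ)) η)| ≤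
          C * w (l m)) ∧
      (∀ ξ ∈ segC m ξ₀, ∀ η ∈ segC m ξ₀,
        |Real.log (distortion (F^[q (m + 1)]) ξ₀ ξ
            (F^[q (m + 2)] ξ₀ - (p (m + 2) : ℝ)) η)| ≤
          C * w (l (m + 2))) := by
  obtain ⟨f, hf⟩ : ∃ f : CircleDeg1Lift, ⇑f = F := ⟨⟨⟨F, hF.monotone⟩, hFp⟩, rfl⟩
  have hτ : CircleDeg1Lift.translationNumber f = ρ := by
    refine tendsto_nhds_unique (f.tendsto_translationNumber 0) ?_
    simpa [CircleDeg1Lift.coe_pow, hf] using hrot 0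
  have hirr' : Irrational (CircleDeg1Lift.translationNumber f) := hτ ▸ hirr
  have heq : ∀ {i j : ℕ} {n : ℤ} (x : ℝ), F^[i] x = F^[j] x + n ↔ i = j ∧ n = 0 :=
    fun x => hf ▸ f.iterate_eq_iff hirr' x
  have hlt : ∀ {i j : ℕ} {n : ℤ} (x : ℝ), F^[i] x < F^[j] x + n ↔ i * ρ < j * ρ + n :=
    fun x => by
      rw [← hf, ← hτ]
      exact f.iterate_lt_iff hirr' x
  have hdet := convergent_det hp0 hp1 hq0 hprec hqrec
  have hsign := convergent_error_sign hk hp0 hp1 hq0 hq1 hprec hqrec hconv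
  have hqpos := convergent_denom_pos hk hq0 hq1 hqrec
  obtain ⟨⟨μ, hμ, hμF⟩, ⟨M, hMF⟩⟩ := exists_bounds_deriv hFp hF' hF'' hF'pos
  obtain ⟨B, hB⟩ := exists_bound_second_deriv hw hFp hF' hF'' hmod
  have hshift : ∀ (i j r : ℕ) (x : ℝ), F^[i] (F^[j] x - r) = F^[j] (F^[i] x) - r := by
    intro i j r x
    have := f.iterate_add_int i (F^[j] x) (-r)
    push_cast at this
    rw [hf, ← sub_eq_add_neg, ← sub_eq_add_neg] at this
    rw [this, ← Function.iterate_add_apply, ← Function.iterate_add_apply, add_comm]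
  have hle : ∀ n x, |F^[q n] x - x - (p n : ℝ)| ≤ l n := by
    intro n x
    rw [hl]
    refine le_ciSup (f := fun x => |F^[q n] x - x - (p n : ℝ)|) ?_ x
    refine ⟨|q n * ρ - p n| + 1, ?_⟩
    rintro _ ⟨y, rfl⟩
    have h := hf ▸ f.abs_iterate_sub_sub_le (q n) y
    rw [hτ] at h
    calc |F^[q n] y - y - p n| = |(F^[q n] y - y - q n * ρ) + (q n * ρ - p n)| := by ring_nf
      _ ≤ _ := abs_add_le _ _
      _ ≤ _ := by linarith
  intro ξ₀
  refine ⟨2 * ((B ^ 2 / w 1 + 2 * M) / μ ^ 2), ?_, fun m => ?_⟩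
  · have := hw.pos 1 one_pos
    have := hμ.trans_le ((hμF 0).trans (hMF 0))
    positivity
  have hne : ∀ n, ξ₀ ≠ F^[q n] ξ₀ - p n := fun n h => by
    have := (heq (i := 0) (j := q n) (n := -p n) ξ₀).mp (by
      push_cast
      rwa [← sub_eq_add_neg])
    have := hqpos n
    omega
  have hΛ : ∀ n i, |F^[i] ξ₀ - F^[i] (F^[q n] ξ₀ - p n)| ≤ l n := fun n i => by
    rw [hshift, abs_sub_comm]
    convert hle n (F^[i] ξ₀) using 2
    ring
  have hgap : ∀ i < q (m + 1), ∀ j < q (m + 1), ∀ n : ℤ, (i : ℝ) * ρ < j * ρ + n →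
      j * ρ + n < i * ρ + (-1) ^ m * (q m * ρ - p m) → False := by
    intro i hi j hj n h1 h2
    have := eq_zero_of_abs_lt_convergent_error hdet hsign (m := m) (a := (j : ℤ) - i) (n := n)
      (abs_lt.mpr ⟨by omega, by omega⟩) (by
        push_cast
        rw [abs_of_pos (by linarith)]
        linarith)
    obtain ⟨rfl, rfl⟩ : j = i ∧ n = 0 := by omega
    simp at h1
  obtain ⟨α, β, hαβ, hseg, hsum⟩ : ∃ α β, α < β ∧ segC m ξ₀ = Set.Icc α β ∧
      ∑ i ∈ Finset.range (q (m + 1)), (F^[i] β - F^[i] α) ≤ 1 := by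
    have hiter : ∀ i, F^[i] (F^[q m] ξ₀ - p m) = F^[i + q m] ξ₀ - p m := fun i => by
      rw [hshift, ← Function.iterate_add_apply, add_comm]
    rw [hsegC]
    have hs := hsign m
    by_cases hm : Even m
    · rw [if_pos hm]
      rw [hm.neg_one_pow, one_mul] at hs hgap
      have h0 : ξ₀ < F^[q m] ξ₀ - p m := by
        have := (hlt (i := 0) (j := q m) (n := -p m) ξ₀).mpr (by push_cast; linarith)
        push_cast at this
        rwa [← sub_eq_add_neg] at this
      refine ⟨_, _, h0, rfl, sum_sub_le_one (fun i _ => hF.iterate i h0)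
        (fun i _ j _ n => (heq ξ₀).mp) fun i hi j hj n h => ?_⟩
      by_contra! h'
      rw [hiter] at h'
      have h2 := (hlt (i := j) (j := i + q m) (n := -p m - n) ξ₀).mp (by push_cast; linarith)
      push_cast at h2
      exact hgap i hi j hj n ((hlt ξ₀).mp h) (by linarith)
    · rw [if_neg hm]
      rw [(Nat.not_even_iff_odd.mp hm).neg_one_pow] at hs hgap
      have h0 : F^[q m] ξ₀ - p m < ξ₀ := by
        have := (hlt (i := q m) (j := 0) (n := p m) ξ₀).mpr (by push_cast; linarith)
        push_cast at this
        simp only [Function.iterate_zero, id] at this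
        linarith
      refine ⟨_, _, h0, rfl, sum_sub_le_one (fun i _ => hF.iterate i h0)
        (fun i _ j _ n h => ?_) fun i hi j hj n h => ?_⟩
      · rw [hiter, hiter] at h
        have := (heq (i := i + q m) (j := j + q m) (n := n) ξ₀).mp (by linarith)
        omega
      · by_contra! h'
        rw [hiter, hiter] at h
        rw [hiter] at h'
        have h1 := (hlt (i := i + q m) (j := j + q m) (n := n) ξ₀).mp (by linarith)
        have h2 := (hlt (i := j + q m) (j := i) (n := p m - n) ξ₀).mp (by push_cast; linarith)
        push_cast at h1 h2
        exact hgap i hi j hj n (by linarith) (by linarith)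
  have hmem0 : ξ₀ ∈ segC m ξ₀ := by
    rw [hsegC]
    rw [hsegC] at hseg
    split_ifs with hm
    · rw [if_pos hm] at hseg
      exact Set.left_mem_Icc.mpr (Set.nonempty_Icc.mp (hseg ▸ Set.nonempty_Icc.mpr hαβ.le))
    · rw [if_neg hm] at hseg
      exact Set.right_mem_Icc.mpr (Set.nonempty_Icc.mp (hseg ▸ Set.nonempty_Icc.mpr hαβ.le))
  have hmem1 : F^[q m] ξ₀ - p m ∈ segC m ξ₀ := by
    rw [hsegC] at hmem0 ⊢
    split_ifs with hm
    · rw [if_pos hm] at hmem0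
      exact Set.right_mem_Icc.mpr (hmem0.1.trans hmem0.2)
    · rw [if_neg hm] at hmem0
      exact Set.left_mem_Icc.mpr (hmem0.1.trans hmem0.2)
  have hmem2 : F^[q (m + 2)] ξ₀ - p (m + 2) ∈ segC m ξ₀ := by
    have hs1 := hsign (m + 1)
    have hs2 := hsign (m + 2)
    have hkm : (0 : ℝ) < k (m + 2) := Nat.cast_pos.mpr (hk (m + 1))
    have hrec : (q (m + 2) * ρ - p (m + 2) : ℝ) =
        k (m + 2) * (q (m + 1) * ρ - p (m + 1)) + (q m * ρ - p m) := by
      rw [hprec, hqrec]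
      push_cast
      ring
    rw [hsegC]
    by_cases hm : Even m
    · rw [if_pos hm]
      rw [hm.add_one.neg_one_pow] at hs1
      rw [(hm.add even_two).neg_one_pow, one_mul] at hs2
      have h1 := (hlt (i := 0) (j := q (m + 2)) (n := -p (m + 2)) ξ₀).mpr
        (by push_cast; linarith)
      have h2 := (hlt (i := q (m + 2)) (j := q m) (n := p (m + 2) - p m) ξ₀).mpr
        (by push_cast; nlinarith)
      push_cast at h1 h2
      simp only [Function.iterate_zero, id] at h1
      exact ⟨by linarith, by linarith⟩
    · rw [if_neg hm]
      rw [(Nat.not_even_iff_odd.mp hm).add_one.neg_one_pow, one_mul] at hs1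
      rw [((Nat.not_even_iff_odd.mp hm).add_even even_two).neg_one_pow] at hs2
      have h1 := (hlt (i := q (m + 2)) (j := 0) (n := p (m + 2)) ξ₀).mpr
        (by push_cast; linarith)
      have h2 := (hlt (i := q m) (j := q (m + 2)) (n := p m - p (m + 2)) ξ₀).mpr
        (by push_cast; nlinarith)
      push_cast at h1 h2
      simp only [Function.iterate_zero, id] at h1
      exact ⟨by linarith, by linarith⟩
  rw [hseg] at hmem0 hmem1 hmem2 ⊢
  exact ⟨fun ξ hξ η hη => abs_log_distortion_iterate_le hw hF hF' hF'' hmod hμ hμF hMF hB hαβ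
      hsum hmem0 hξ hmem1 hη (hne m) (hΛ m),
    fun ξ hξ η hη => abs_log_distortion_iterate_le hw hF hF' hF'' hmod hμ hμF hMF hB hαβ
      hsum hmem0 hξ hmem2 hη (hne (m + 2)) (hΛ (m + 2))⟩
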